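/- The function α̂(e) := (2(1−e²)² + 4)J₁(e) − e(6−e²)J₁'(e) has exactly one zero on the interval 0 < e < 1, and this zero is simple (the derivative of α̂ is nonzero there). Equivalently, the partial derivative ∂A₁/∂G = −√(1−e²)·(4/(Le⁴))·α̂(e) of the Fourier coefficient A₁ with respect to the Delaunay action G (with L > 0 fixed) has exactly one simple zero for 0 < e < 1. -/

import Mathlib

open Real Set

/-- Bessel function of integer order `n`. -/
noncomputable def besselJ (n : ℤ) (x : ℝ) : ℝ :=
  (1 / (2 * π)) * ∫ t in (0:ℝ)..(2 * π), Real.cos (n * t - x * Real.sin t)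

/-- Derivative of the Bessel function with respect to its argument. -/
noncomputable def besselJd (n : ℤ) (x : ℝ) : ℝ := deriv (besselJ n) x

/-- The Fourier coefficient `A_m(e)`. -/
noncomputable def coefA (m : ℕ) (e : ℝ) : ℝ :=
  (4 / ((m:ℝ) ^ 2 * e ^ 2)) *
    (2 * m * e * (1 - e ^ 2) * besselJd m (m * e) - (2 - e ^ 2) * besselJ m (m * e))

/-- The Fourier coefficient `B_m(e)`. -/
noncomputable def coefB (m : ℕ) (e : ℝ) : ℝ :=
  -(8 / ((m:ℝ) ^ 2 * e ^ 2)) * Real.sqrt (1 - e ^ 2) *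
    (e * besselJd m (m * e) - m * (1 - e ^ 2) * besselJ m (m * e))

/-- The function `α̂(e) = (2(1−e²)²+4)J₁(e) − e(6−e²)J₁'(e)`, a negative nonvanishing
multiple of `∂A₁/∂G`. -/
noncomputable def alphaHat (e : ℝ) : ℝ :=
  (2 * (1 - e ^ 2) ^ 2 + 4) * besselJ 1 e - e * (6 - e ^ 2) * besselJd 1 e

lemma h1mono : Monotone (fun y : ℝ => Real.sin y - y + y ^ 3 / 6) := by
  apply monotone_of_hasDerivAt_nonneg (f' := fun y => Real.cos y - 1 + y ^ 2 / 2)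
  · intro y
    have := ((Real.hasDerivAt_sin y).sub (hasDerivAt_id y)).add ((hasDerivAt_pow 3 y).div_const 6)
    refine this.congr_deriv ?_
    norm_num; ring
  · intro y
    have := Real.one_sub_sq_div_two_le_cos (x := y)
    show 0 ≤ Real.cos y - 1 + y ^ 2 / 2
    linarith

lemma h2nonneg (y : ℝ) : 0 ≤ 1 - y ^ 2 / 2 + y ^ 4 / 24 - Real.cos y := by
  have key : ∀ y : ℝ, 0 ≤ y → 0 ≤ 1 - y ^ 2 / 2 + y ^ 4 / 24 - Real.cos y := by
    intro y hy
    have hd : ∀ z : ℝ, HasDerivAt (fun y : ℝ => 1 - y ^ 2 / 2 + y ^ 4 / 24 - Real.cos y)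
        (Real.sin z - z + z ^ 3 / 6) z := by
      intro z
      have := (((((hasDerivAt_pow 2 z).div_const 2).const_sub 1)).add
        ((hasDerivAt_pow 4 z).div_const 24)).sub (Real.hasDerivAt_cos z)
      refine this.congr_deriv ?_
      norm_num; ring
    have hm : MonotoneOn (fun y : ℝ => 1 - y ^ 2 / 2 + y ^ 4 / 24 - Real.cos y) (Set.Ici 0) := by
      apply monotoneOn_of_deriv_nonneg (convex_Ici 0)
      · exact fun z _ => (hd z).continuousAt.continuousWithinAt
      · exact fun z _ => (hd z).differentiableAt.differentiableWithinAt
      · intro z hz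
        rw [interior_Ici] at hz
        rw [(hd z).deriv]
        have := h1mono (le_of_lt hz)
        simpa using this
    have := hm (Set.mem_Ici.2 le_rfl) (Set.mem_Ici.2 hy) hy
    simpa using this
  rcases le_total 0 y with h | h
  · exact key y h
  · have := key (-y) (by linarith)
    rw [Real.cos_neg] at this
    have e1 : (-y) ^ 2 = y ^ 2 := by ring
    have e2 : (-y) ^ 4 = y ^ 4 := by ring
    rwa [e1, e2] at this

lemma h3mono : Monotone (fun y : ℝ => y - y ^ 3 / 6 + y ^ 5 / 120 - Real.sin y) := by
  apply monotone_of_hasDerivAt_nonneg (f' := fun y => 1 - y ^ 2 / 2 + y ^ 4 / 24 - Real.cos y)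
  · intro y
    have := (((hasDerivAt_id y).sub ((hasDerivAt_pow 3 y).div_const 6)).add
      ((hasDerivAt_pow 5 y).div_const 120)).sub (Real.hasDerivAt_sin y)
    refine this.congr_deriv ?_
    norm_num; ring
  · exact h2nonneg

lemma ysin_lower (y : ℝ) : y * (y - y ^ 3 / 6) ≤ y * Real.sin y := by
  rcases le_total 0 y with h | h
  · have := h1mono h
    norm_num at this
    nlinarith
  · have := h1mono h
    norm_num at this
    nlinarith

lemma ysin_upper (y : ℝ) : y * Real.sin y ≤ y * (y - y ^ 3 / 6 + y ^ 5 / 120) := by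
  rcases le_total 0 y with h | h
  · have := h3mono h
    norm_num at this
    nlinarith
  · have := h3mono h
    norm_num at this
    nlinarith

lemma ssin_lower (x s : ℝ) (hx : 0 < x) : x * s ^ 2 - x ^ 3 / 6 * s ^ 4 ≤ s * Real.sin (x * s) := by
  have := ysin_lower (x * s)
  refine le_of_mul_le_mul_left ?_ hx
  linarith

lemma ssin_upper (x s : ℝ) (hx : 0 < x) :
    s * Real.sin (x * s) ≤ x * s ^ 2 - x ^ 3 / 6 * s ^ 4 + x ^ 5 / 120 * s ^ 6 := by
  have := ysin_upper (x * s)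
  refine le_of_mul_le_mul_left ?_ hx
  linarith

lemma m2 : ∫ t in (0:ℝ)..(2 * π), Real.sin t ^ 2 = π := by
  rw [integral_sin_sq]; simp
lemma m4 : ∫ t in (0:ℝ)..(2 * π), Real.sin t ^ 4 = 3 * π / 4 := by
  have := integral_sin_pow (a := 0) (b := 2 * π) 2
  norm_num at this
  rw [this]; ring
lemma m6 : ∫ t in (0:ℝ)..(2 * π), Real.sin t ^ 6 = 5 * π / 8 := by
  have := integral_sin_pow (a := 0) (b := 2 * π) 4
  norm_num [m4] at this
  rw [this]; ring

noncomputable def Ja (x : ℝ) : ℝ :=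
  (1 / (2 * π)) * ∫ t in (0:ℝ)..(2 * π), Real.sin t * Real.sin (x * Real.sin t)
noncomputable def Jb (x : ℝ) : ℝ :=
  (1 / (2 * π)) * ∫ t in (0:ℝ)..(2 * π), Real.sin t ^ 2 * Real.cos (x * Real.sin t)
noncomputable def Jc (x : ℝ) : ℝ :=
  (1 / (2 * π)) * ∫ t in (0:ℝ)..(2 * π), Real.sin t ^ 3 * Real.sin (x * Real.sin t)

lemma int2 (p q : ℝ) : (1 / (2 * π)) * ∫ t in (0:ℝ)..(2 * π),
    (p * Real.sin t ^ 2 + q * Real.sin t ^ 4) = p / 2 + q * 3 / 8 := by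
  rw [intervalIntegral.integral_add (by apply Continuous.intervalIntegrable; fun_prop)
    (by apply Continuous.intervalIntegrable; fun_prop)]
  simp only [intervalIntegral.integral_const_mul, m2, m4]
  have := Real.pi_pos
  field_simp
  ring

lemma int3 (p q r : ℝ) : (1 / (2 * π)) * ∫ t in (0:ℝ)..(2 * π),
    (p * Real.sin t ^ 2 + q * Real.sin t ^ 4 + r * Real.sin t ^ 6)
      = p / 2 + q * 3 / 8 + r * 5 / 16 := by
  rw [intervalIntegral.integral_add (by apply Continuous.intervalIntegrable; fun_prop)
    (by apply Continuous.intervalIntegrable; fun_prop), mul_add, int2]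
  simp only [intervalIntegral.integral_const_mul, m6]
  have := Real.pi_pos
  field_simp
  ring

lemma int_mono (f g : ℝ → ℝ) (hf : Continuous f) (hg : Continuous g) (h : ∀ t, f t ≤ g t) :
    (1 / (2 * π)) * ∫ t in (0:ℝ)..(2 * π), f t ≤ (1 / (2 * π)) * ∫ t in (0:ℝ)..(2 * π), g t := by
  have := Real.pi_pos
  apply mul_le_mul_of_nonneg_left _ (by positivity)
  exact intervalIntegral.integral_mono (by positivity) (hf.intervalIntegrable _ _)
    (hg.intervalIntegrable _ _) h

lemma Ja_lower (x : ℝ) (hx : 0 < x) : x / 2 - x ^ 3 / 16 ≤ Ja x := by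
  have := int_mono (fun t => x * Real.sin t ^ 2 + (-x ^ 3 / 6) * Real.sin t ^ 4)
    (fun t => Real.sin t * Real.sin (x * Real.sin t)) (by fun_prop) (by fun_prop)
    (fun t => by have := ssin_lower x (Real.sin t) hx; linarith)
  rw [int2] at this
  unfold Ja; linarith

lemma Ja_upper (x : ℝ) (hx : 0 < x) : Ja x ≤ x / 2 - x ^ 3 / 16 + x ^ 5 / 384 := by
  have := int_mono (fun t => Real.sin t * Real.sin (x * Real.sin t))
    (fun t => x * Real.sin t ^ 2 + (-x ^ 3 / 6) * Real.sin t ^ 4 + x ^ 5 / 120 * Real.sin t ^ 6)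
    (by fun_prop) (by fun_prop)
    (fun t => by have := ssin_upper x (Real.sin t) hx; linarith)
  rw [int3] at this
  unfold Ja; linarith

lemma Jb_lower (x : ℝ) : 1 / 2 - 3 * x ^ 2 / 16 ≤ Jb x := by
  have := int_mono (fun t => 1 * Real.sin t ^ 2 + (-x ^ 2 / 2) * Real.sin t ^ 4)
    (fun t => Real.sin t ^ 2 * Real.cos (x * Real.sin t)) (by fun_prop) (by fun_prop)
    (fun t => by
      have := Real.one_sub_sq_div_two_le_cos (x := x * Real.sin t)
      have := mul_le_mul_of_nonneg_left this (sq_nonneg (Real.sin t))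
      linarith)
  rw [int2] at this
  unfold Jb; linarith

lemma Jb_upper (x : ℝ) : Jb x ≤ 1 / 2 - 3 * x ^ 2 / 16 + 5 * x ^ 4 / 384 := by
  have := int_mono (fun t => Real.sin t ^ 2 * Real.cos (x * Real.sin t))
    (fun t => 1 * Real.sin t ^ 2 + (-x ^ 2 / 2) * Real.sin t ^ 4 + x ^ 4 / 24 * Real.sin t ^ 6)
    (by fun_prop) (by fun_prop)
    (fun t => by
      have := h2nonneg (x * Real.sin t)
      have := mul_nonneg (sq_nonneg (Real.sin t)) this
      linarith)
  rw [int3] at this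
  unfold Jb; linarith

lemma Jc_lower (x : ℝ) (hx : 0 < x) : 3 * x / 8 - 5 * x ^ 3 / 96 ≤ Jc x := by
  have := int_mono
    (fun t => 0 * Real.sin t ^ 2 + x * Real.sin t ^ 4 + (-x ^ 3 / 6) * Real.sin t ^ 6)
    (fun t => Real.sin t ^ 3 * Real.sin (x * Real.sin t)) (by fun_prop) (by fun_prop)
    (fun t => by
      have := ssin_lower x (Real.sin t) hx
      have := mul_le_mul_of_nonneg_left this (sq_nonneg (Real.sin t))
      linarith)
  rw [int3] at this
  unfold Jc; linarith

lemma besselJ_eq (x : ℝ) : besselJ 1 x = Ja x := by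
  unfold besselJ Ja
  congr 1
  have h0 : ∫ t in (0:ℝ)..(2 * π), Real.cos t * Real.cos (x * Real.sin t) = 0 := by
    by_cases hx : x = 0
    · simp [hx]
    · have hd : ∀ t ∈ Set.uIcc (0:ℝ) (2 * π), HasDerivAt (fun t => Real.sin (x * Real.sin t) / x)
          (Real.cos t * Real.cos (x * Real.sin t)) t := by
        intro t _
        have := (((Real.hasDerivAt_sin t).const_mul x).sin).div_const x
        refine this.congr_deriv ?_
        field_simp
      rw [intervalIntegral.integral_eq_sub_of_hasDerivAt hd
        (by apply Continuous.intervalIntegrable; fun_prop)]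
      simp
  have : ∀ t : ℝ, Real.cos (((1:ℤ):ℝ) * t - x * Real.sin t)
      = Real.cos t * Real.cos (x * Real.sin t) + Real.sin t * Real.sin (x * Real.sin t) := by
    intro t
    rw [Int.cast_one, one_mul, Real.cos_sub]
  simp only [this]
  rw [intervalIntegral.integral_add (by apply Continuous.intervalIntegrable; fun_prop)
    (by apply Continuous.intervalIntegrable; fun_prop), h0, zero_add]

lemma diff_int (F F' : ℝ → ℝ → ℝ) (hF : ∀ x, Continuous (F x)) (hF' : ∀ x, Continuous (F' x))
    (hb : ∀ x t, |F' x t| ≤ 1) (hd : ∀ x t, HasDerivAt (fun y => F y t) (F' x t) x) (x : ℝ) :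
    HasDerivAt (fun y => (1 / (2 * π)) * ∫ t in (0:ℝ)..(2 * π), F y t)
      ((1 / (2 * π)) * ∫ t in (0:ℝ)..(2 * π), F' x t) x := by
  apply HasDerivAt.const_mul
  refine (intervalIntegral.hasDerivAt_integral_of_dominated_loc_of_deriv_le (bound := fun _ => 1)
    (s := Set.univ) Filter.univ_mem ?_ ?_ ?_ ?_ ?_ ?_).2
  · exact Filter.Eventually.of_forall fun y => (hF y).aestronglyMeasurable
  · exact (hF x).intervalIntegrable _ _
  · exact (hF' x).aestronglyMeasurable
  · exact Filter.Eventually.of_forall fun t _ y _ => hb y t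
  · exact intervalIntegrable_const
  · exact Filter.Eventually.of_forall fun t _ y _ => hd y t

lemma Ja_deriv (x : ℝ) : HasDerivAt Ja (Jb x) x := by
  refine diff_int (fun x t => Real.sin t * Real.sin (x * Real.sin t))
    (fun x t => Real.sin t ^ 2 * Real.cos (x * Real.sin t)) (fun x => by fun_prop)
    (fun x => by fun_prop) ?_ ?_ x
  · intro x t
    rw [abs_mul, abs_pow]
    exact mul_le_one₀ (pow_le_one₀ (abs_nonneg _) (Real.abs_sin_le_one _)) (abs_nonneg _)
      (Real.abs_cos_le_one _)
  · intro x t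
    have := (((hasDerivAt_id x).mul_const (Real.sin t)).sin).const_mul (Real.sin t)
    refine this.congr_deriv ?_
    simp only [id]; ring

lemma Jb_deriv (x : ℝ) : HasDerivAt Jb (-Jc x) x := by
  have := diff_int (fun x t => Real.sin t ^ 2 * Real.cos (x * Real.sin t))
    (fun x t => -(Real.sin t ^ 3 * Real.sin (x * Real.sin t))) (fun x => by fun_prop)
    (fun x => by fun_prop) ?_ ?_ x
  · refine this.congr_deriv ?_
    unfold Jc
    rw [intervalIntegral.integral_neg]; ring
  · intro x t
    rw [abs_neg, abs_mul, abs_pow]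
    exact mul_le_one₀ (pow_le_one₀ (abs_nonneg _) (Real.abs_sin_le_one _)) (abs_nonneg _)
      (Real.abs_sin_le_one _)
  · intro x t
    have := (((hasDerivAt_id x).mul_const (Real.sin t)).cos).const_mul (Real.sin t ^ 2)
    refine this.congr_deriv ?_
    simp only [id]; ring

lemma besselJd_eq (x : ℝ) : besselJd 1 x = Jb x := by
  unfold besselJd
  rw [show besselJ 1 = Ja from funext besselJ_eq]
  exact (Ja_deriv x).deriv

lemma alphaHat_eq : alphaHat =
    fun e => (2 * (1 - e ^ 2) ^ 2 + 4) * Ja e - e * (6 - e ^ 2) * Jb e := by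
  funext e
  rw [alphaHat, besselJ_eq, besselJd_eq]

lemma alpha_deriv (e : ℝ) : HasDerivAt alphaHat
    ((-8 * e + 8 * e ^ 3) * Ja e + (-e ^ 2 + 2 * e ^ 4) * Jb e + e * (6 - e ^ 2) * Jc e) e := by
  rw [alphaHat_eq]
  have hp : HasDerivAt (fun e : ℝ => 2 * (1 - e ^ 2) ^ 2 + 4) (-8 * e + 8 * e ^ 3) e := by
    have := ((((hasDerivAt_pow 2 e).const_sub 1).pow 2).const_mul 2).add_const 4
    refine this.congr_deriv ?_
    norm_num; ring
  have hq : HasDerivAt (fun e : ℝ => e * (6 - e ^ 2)) (6 - 3 * e ^ 2) e := by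
    have := (hasDerivAt_id e).mul ((hasDerivAt_pow 2 e).const_sub 6)
    refine this.congr_deriv ?_
    norm_num; ring
  have := (hp.mul (Ja_deriv e)).sub (hq.mul (Jb_deriv e))
  refine this.congr_deriv ?_
  ring

lemma alpha_neg (e : ℝ) (h0 : 0 < e) (h : e ^ 2 ≤ 3 / 5) : alphaHat e < 0 := by
  rw [alphaHat_eq]
  have h1 := mul_le_mul_of_nonneg_left (Ja_upper e h0)
    (by positivity : 0 ≤ 2 * (1 - e ^ 2) ^ 2 + 4)
  have h2 := mul_le_mul_of_nonneg_left (Jb_lower e)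
    (mul_nonneg h0.le (by linarith) : 0 ≤ e * (6 - e ^ 2))
  have key : (2 * (1 - e ^ 2) ^ 2 + 4) * (e / 2 - e ^ 3 / 16 + e ^ 5 / 384)
     - e * (6 - e ^ 2) * (1 / 2 - 3 * e ^ 2 / 16) = e ^ 3 * (-(3 / 4) + 69 / 64 * e ^ 2
       - 13 / 96 * (e ^ 2) ^ 2 + (e ^ 2) ^ 3 / 192) := by ring
  have : 0 < e ^ 3 := by positivity
  have hu : 0 < e ^ 2 := by positivity
  have : -(3 / 4) + 69 / 64 * e ^ 2 - 13 / 96 * (e ^ 2) ^ 2 + (e ^ 2) ^ 3 / 192 < 0 := by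
    generalize e ^ 2 = u at *
    nlinarith [mul_nonneg (sq_nonneg u) (sub_nonneg.2 h)]
  simp only
  nlinarith

lemma alpha_one : 0 < alphaHat 1 := by
  rw [alphaHat_eq]
  have h1 := Ja_lower 1 one_pos
  have h2 := Jb_upper 1
  norm_num at *
  linarith

lemma alpha_deriv_pos (e : ℝ) (h0 : 0 < e) (h1 : e ≤ 1) (h : 3 / 5 ≤ e ^ 2) :
    0 < (-8 * e + 8 * e ^ 3) * Ja e + (-e ^ 2 + 2 * e ^ 4) * Jb e + e * (6 - e ^ 2) * Jc e := by
  have hu1 : e ^ 2 ≤ 1 := by nlinarith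
  have a1 := mul_le_mul_of_nonneg_left (Ja_upper e h0)
    (by nlinarith : 0 ≤ 8 * e - 8 * e ^ 3)
  have a2 := mul_le_mul_of_nonneg_left (Jb_lower e)
    (by nlinarith : 0 ≤ -e ^ 2 + 2 * e ^ 4)
  have a3 := mul_le_mul_of_nonneg_left (Jc_lower e h0)
    (mul_nonneg h0.le (by linarith) : 0 ≤ e * (6 - e ^ 2))
  have key : -((8 * e - 8 * e ^ 3) * (e / 2 - e ^ 3 / 16 + e ^ 5 / 384))
     + (-e ^ 2 + 2 * e ^ 4) * (1 / 2 - 3 * e ^ 2 / 16)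
     + e * (6 - e ^ 2) * (3 * e / 8 - 5 * e ^ 3 / 96) = e ^ 2 * (-(9 / 4) + 5 * e ^ 2
       - (7 / 8 + 1 / 48 - 5 / 96) * (e ^ 2) ^ 2 + (e ^ 2) ^ 3 / 48) := by ring
  have hu : 0 < e ^ 2 := by positivity
  have : 0 < (-(9 / 4) + 5 * e ^ 2
       - (7 / 8 + 1 / 48 - 5 / 96) * (e ^ 2) ^ 2 + (e ^ 2) ^ 3 / 48) := by
    have : 0 < (e ^ 2) ^ 3 := by positivity
    generalize e ^ 2 = u at *
    nlinarith
  have := mul_pos hu this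
  linarith

theorem stmt_5 :
    ∃ e₀ ∈ Set.Ioo (0:ℝ) 1, alphaHat e₀ = 0 ∧ deriv alphaHat e₀ ≠ 0 ∧
      ∀ e ∈ Set.Ioo (0:ℝ) 1, alphaHat e = 0 → e = e₀ := by
  have hc : Continuous alphaHat :=
    continuous_iff_continuousAt.2 fun x => (alpha_deriv x).continuousAt
  have big : ∀ e ∈ Set.Ioo (0:ℝ) 1, alphaHat e = 0 → 3 / 5 < e ^ 2 := by
    intro e he h
    by_contra! hh
    exact (alpha_neg e he.1 hh).ne h
  have hneg : alphaHat (1 / 2) < 0 := alpha_neg _ (by norm_num) (by norm_num)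
  obtain ⟨e₀, he, hz⟩ := intermediate_value_Ioo (by norm_num : (1 / 2 : ℝ) ≤ 1)
    hc.continuousOn (show (0:ℝ) ∈ Set.Ioo _ _ from ⟨hneg, alpha_one⟩)
  have he' : e₀ ∈ Set.Ioo (0:ℝ) 1 := ⟨by linarith [he.1], he.2⟩
  refine ⟨e₀, he', hz, ?_, ?_⟩
  · rw [(alpha_deriv e₀).deriv]
    exact (alpha_deriv_pos e₀ he'.1 he'.2.le (big e₀ he' hz).le).ne'
  have key : ∀ a ∈ Set.Ioo (0:ℝ) 1, ∀ b ∈ Set.Ioo (0:ℝ) 1, alphaHat a = 0 → alphaHat b = 0 →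
      ¬ a < b := by
    intro a ha b hb hza hzb hab
    have hm : StrictMonoOn alphaHat (Set.Icc a b) := by
      apply strictMonoOn_of_deriv_pos (convex_Icc a b) hc.continuousOn
      intro x hx
      rw [interior_Icc] at hx
      rw [(alpha_deriv x).deriv]
      have := big a ha hza
      exact alpha_deriv_pos x (by linarith [ha.1, hx.1]) (by linarith [hb.2, hx.2])
        (by nlinarith [ha.1, hx.1])
    have := hm (Set.left_mem_Icc.2 hab.le) (Set.right_mem_Icc.2 hab.le) hab
    linarith
  intro e h hz'
  exact le_antisymm (not_lt.1 (key e₀ he' e h hz hz')) (not_lt.1 (key e h e₀ he' hz' hz))
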